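/- Let (Γ,d) be a non-elementary uniformly quasi-geodesic hyperbolic group. Then there is a constant C > 0, depending only on (Γ,d), such that for every g ∈ Γ there exists a sequence {x_i} ⊂ Γ with lim_{i,j→∞} (x_i|x_j)_e = ∞ (a Gromov sequence) and limsup_{i→∞} | d(x_i,g) − d(x_i,e) | ≤ C. (Equivalently: every g ∈ Γ admits a point η in the Gromov boundary with horofunction value |h_η(g)| ≤ C.) -/

import Mathlib

open MeasureTheory Filter Set

/-- `p` is a `(1, c)`-quasi-geodesic on the parameter set `I`. -/
def IsQuasiGeodesicOn {X : Type*} (d : X → X → ℝ) (c : ℝ) (I : Set ℝ) (p : ℝ → X) : Prop :=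
  ∀ i ∈ I, ∀ j ∈ I, |i - j| - c ≤ d (p i) (p j) ∧ d (p i) (p j) ≤ |i - j| + c

/-- The Gromov product of `x` and `y` based at `z`. -/
noncomputable def gromovProd {X : Type*} (d : X → X → ℝ) (x y z : X) : ℝ :=
  (d x z + d y z - d x y) / 2

theorem Ultrafilter.exists_eventually_eq_of_finite {α X : Type*} (U : Ultrafilter α) (f : α → X)
    {S : Set X} (hS : S.Finite) (h : ∀ᶠ n in U, f n ∈ S) : ∃ y, ∀ᶠ n in U, f n = y := by
  have h2 : (⋃ y ∈ S, {n | f n = y}) ∈ U := by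
    filter_upwards [h] with n hn
    simpa using hn
  obtain ⟨y, -, hy⟩ := (Ultrafilter.finite_biUnion_mem_iff hS).1 h2
  exact ⟨y, hy⟩

/-- Pointwise limit, along an ultrafilter, of maps into a proper space. -/
theorem exists_ultralimit {X : Type*} {d : X → X → ℝ} {o : X}
    (hproper : ∀ R : ℝ, {g : X | d o g ≤ R}.Finite) (U : Ultrafilter ℕ) (q : ℕ → ℝ → X)
    (I : Set ℝ) (h : ∀ r ∈ I, ∃ B, ∀ᶠ n in U, d o (q n r) ≤ B) :
    ∃ p : ℝ → X, ∀ r ∈ I, ∀ᶠ n in U, q n r = p r := by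
  have h2 : ∀ r, ∃ y, r ∈ I → ∀ᶠ n in U, q n r = y := by
    intro r
    by_cases hr : r ∈ I
    · obtain ⟨B, hB⟩ := h r hr
      obtain ⟨y, hy⟩ := U.exists_eventually_eq_of_finite (fun n => q n r) (hproper B) hB
      exact ⟨y, fun _ => hy⟩
    · exact ⟨o, fun h => absurd h hr⟩
  choose p hp using h2
  exact ⟨p, hp⟩

/-- Quasi-geodesics based at the same point, defined on sets that exhaust `I`, have an ultralimit
which is a quasi-geodesic on `I`. -/
theorem exists_quasiGeodesic_ultralimit {X : Type*} {d : X → X → ℝ} {o : X} {c : ℝ}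
    (hproper : ∀ R : ℝ, {g : X | d o g ≤ R}.Finite) (U : Ultrafilter ℕ) (q : ℕ → ℝ → X)
    (J : ℕ → Set ℝ) (I : Set ℝ) (hI : (0 : ℝ) ∈ I) (hJ : ∀ r ∈ I, ∀ᶠ n in U, r ∈ J n)
    (hq : ∀ n, IsQuasiGeodesicOn d c (J n) (q n)) (hq0 : ∀ n, q n 0 = o) :
    ∃ p : ℝ → X, IsQuasiGeodesicOn d c I p ∧ p 0 = o ∧
      ∀ r ∈ I, ∀ᶠ n in U, q n r = p r := by
  obtain ⟨p, hp⟩ := exists_ultralimit hproper U q I (by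
    intro r hr
    refine ⟨|0 - r| + c, ?_⟩
    filter_upwards [hJ r hr, hJ 0 hI] with n h1 h2
    have := (hq n 0 h2 r h1).2
    rwa [hq0] at this)
  refine ⟨p, ?_, ?_, hp⟩
  · intro i hi j hj
    obtain ⟨n, h1, h2, h3, h4⟩ :=
      ((hp i hi).and ((hp j hj).and ((hJ i hi).and (hJ j hj)))).exists
    rw [← h1, ← h2]
    exact hq n i h3 j h4
  · obtain ⟨n, hn⟩ := (hp 0 hI).exists
    rw [← hn, hq0]

theorem IsQuasiGeodesicOn.translate {Γ : Type*} [Group Γ] {d : Γ → Γ → ℝ}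
    (hinv : ∀ g x y : Γ, d (g * x) (g * y) = d x y) {c : ℝ} {I J : Set ℝ} {p : ℝ → Γ}
    (hp : IsQuasiGeodesicOn d c I p) (g : Γ) (a : ℝ) (h : ∀ r ∈ J, a + r ∈ I) :
    IsQuasiGeodesicOn d c J (fun r => g * p (a + r)) := by
  intro i hi j hj
  have := hp _ (h i hi) _ (h j hj)
  simpa [hinv] using this

theorem IsQuasiGeodesicOn.mono {X : Type*} {d : X → X → ℝ} {c : ℝ} {I J : Set ℝ} {p : ℝ → X}
    (hp : IsQuasiGeodesicOn d c I p) (h : J ⊆ I) : IsQuasiGeodesicOn d c J p :=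
  fun i hi j hj => hp i (h hi) j (h hj)

theorem IsQuasiGeodesicOn.sub_le_gromovProd {X : Type*} {d : X → X → ℝ}
    {c : ℝ} {p : ℝ → X}
    (hp : IsQuasiGeodesicOn d c (Ici 0) p) {i j : ℝ} (hi : 0 ≤ i) (hij : i ≤ j) :
    i - 3 * c / 2 ≤ gromovProd d (p i) (p j) (p 0) := by
  have h1 := (hp i hi 0 (le_refl (0 : ℝ))).1
  have h2 := (hp j (hi.trans hij) 0 (le_refl (0 : ℝ))).1
  have h3 := (hp i hi j (hi.trans hij)).2
  rw [sub_zero, abs_of_nonneg hi] at h1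
  rw [sub_zero, abs_of_nonneg (hi.trans hij)] at h2
  rw [abs_sub_comm, abs_of_nonneg (sub_nonneg.2 hij)] at h3
  unfold gromovProd
  linarith

/-- In a hyperbolic space, a ray which moves linearly away from another one has bounded Gromov
product with it. -/
theorem gromovProd_le_of_diverge {X : Type*} {d : X → X → ℝ}
    (hsymm : ∀ x y, d x y = d y x) (htri : ∀ x y z, d x z ≤ d x y + d y z) {δ c : ℝ} (hδ : 0 ≤ δ)
    (hc : 0 < c)
    (hhyp : ∀ x y z w, min (gromovProd d x z w) (gromovProd d y z w) - δ ≤ gromovProd d x y w)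
    {p q : ℝ → X} (hp : IsQuasiGeodesicOn d c (Ici 0) p) (hq : IsQuasiGeodesicOn d c (Ici 0) q)
    (h0 : p 0 = q 0) (hpq : ∀ u, 0 ≤ u → u - 2 * c - 1 ≤ d (p u) (q u))
    {i j : ℝ} (hi : 0 ≤ i) (hj : 0 ≤ j) :
    gromovProd d (p i) (q j) (p 0) ≤ 8 * c + 4 * δ + 1 := by
  set L := gromovProd d (p i) (q j) (p 0) with hL
  by_contra! hlt
  have hpi := (hp i hi 0 (le_refl (0 : ℝ))).2
  have hqj := (hq j hj 0 (le_refl (0 : ℝ))).2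
  rw [sub_zero, abs_of_nonneg hi] at hpi
  rw [sub_zero, abs_of_nonneg hj, ← h0] at hqj
  have hLi : L ≤ d (p i) (p 0) := by
    have := htri (q j) (p i) (p 0)
    rw [hL, gromovProd]
    linarith [hsymm (q j) (p i)]
  have hLj : L ≤ d (q j) (p 0) := by
    have := htri (p i) (q j) (p 0)
    rw [hL, gromovProd]
    linarith
  have hu : 0 ≤ L - c := by linarith
  have a1 := hp.sub_le_gromovProd hu (by linarith : L - c ≤ i)
  have a2 := hq.sub_le_gromovProd hu (by linarith : L - c ≤ j)
  rw [← h0] at a2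
  have b1 := hhyp (p (L - c)) (q j) (p i) (p 0)
  have b2 := hhyp (p (L - c)) (q (L - c)) (q j) (p 0)
  have hcomm : gromovProd d (q j) (p i) (p 0) = L := by
    rw [hL, gromovProd, gromovProd, hsymm (q j) (p i)]
    ring
  rw [hcomm] at b1
  have m1 : L - c - 3 * c / 2 ≤ min (gromovProd d (p (L - c)) (p i) (p 0)) L :=
    le_min a1 (by linarith)
  have m2 : L - c - 3 * c / 2 - δ ≤
      min (gromovProd d (p (L - c)) (q j) (p 0)) (gromovProd d (q (L - c)) (q j) (p 0)) :=
    le_min (by linarith) (by linarith)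
  have e1 := (hp _ hu 0 (le_refl (0 : ℝ))).2
  have e2 := (hq _ hu 0 (le_refl (0 : ℝ))).2
  rw [sub_zero, abs_of_nonneg hu] at e1 e2
  rw [← h0] at e2
  have e3 := hpq _ hu
  have : gromovProd d (p (L - c)) (q (L - c)) (p 0) ≤ (L - c) / 2 + 2 * c + 1 / 2 := by
    rw [gromovProd]
    linarith
  linarith

/-- An infinite uniformly quasi-geodesic proper group contains a bi-infinite quasi-geodesic. -/
theorem exists_biinfinite_quasiGeodesic {Γ : Type*} [Group Γ] [Infinite Γ] {d : Γ → Γ → ℝ}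
    (hinv : ∀ g x y : Γ, d (g * x) (g * y) = d x y)
    (hproper : ∀ R : ℝ, {g : Γ | d 1 g ≤ R}.Finite) {c : ℝ}
    (hqg : ∀ x y : Γ, ∃ (s t : ℝ) (γ : ℝ → Γ), s ≤ t ∧ γ s = x ∧ γ t = y ∧
      IsQuasiGeodesicOn d c (Icc s t) γ) :
    ∃ p : ℝ → Γ, IsQuasiGeodesicOn d c univ p := by
  have h : ∀ n : ℕ, ∃ q : ℝ → Γ, IsQuasiGeodesicOn d c (Icc (-n) n) q ∧ q 0 = 1 := by
    intro n
    obtain ⟨x, hx⟩ := (hproper (2 * n + c)).infinite_compl.nonempty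
    have hx : 2 * n + c < d 1 x := not_le.1 hx
    obtain ⟨s, t, γ, hst, hs, rfl, hγ⟩ := hqg 1 x
    have h1 := (hγ s ⟨le_rfl, hst⟩ t ⟨hst, le_rfl⟩).2
    rw [hs, abs_sub_comm, abs_of_nonneg (sub_nonneg.2 hst)] at h1
    refine ⟨_, hγ.translate hinv (γ ((s + t) / 2 + 0))⁻¹ ((s + t) / 2) ?_, inv_mul_cancel _⟩
    rintro r ⟨hr1, hr2⟩
    constructor <;> linarith
  choose q hq hq0 using h
  obtain ⟨p, hp, -⟩ := exists_quasiGeodesic_ultralimit hproper (hyperfilter ℕ) q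
    (fun n => Icc (-n) n) univ (mem_univ _) (by
      intro r _
      refine Filter.Eventually.filter_mono Nat.hyperfilter_le_atTop ?_
      filter_upwards [eventually_ge_atTop ⌈|r|⌉₊] with n hn
      exact abs_le.1 ((Nat.le_ceil _).trans (by exact_mod_cast hn))) hq hq0
  exact ⟨p, hp⟩

/-- If a bi-infinite quasi-geodesic is not coarsely dense, there is a bi-infinite quasi-geodesic
`q` through the identity and a ray leaving it orthogonally. -/
theorem exists_orthogonal_ray {Γ : Type*} [Group Γ] {d : Γ → Γ → ℝ}
    (hsymm : ∀ x y : Γ, d x y = d y x) (htri : ∀ x y z : Γ, d x z ≤ d x y + d y z)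
    (hnonneg : ∀ x y : Γ, 0 ≤ d x y)
    (hinv : ∀ g x y : Γ, d (g * x) (g * y) = d x y)
    (hproper : ∀ R : ℝ, {g : Γ | d 1 g ≤ R}.Finite) {c : ℝ}
    (hqg : ∀ x y : Γ, ∃ (s t : ℝ) (γ : ℝ → Γ), s ≤ t ∧ γ s = x ∧ γ t = y ∧
      IsQuasiGeodesicOn d c (Icc s t) γ)
    {p : ℝ → Γ} (hp : IsQuasiGeodesicOn d c univ p) (hfar : ∀ R : ℝ, ∃ x, ∀ r, R < d x (p r)) :
    ∃ q γ : ℝ → Γ, IsQuasiGeodesicOn d c univ q ∧ IsQuasiGeodesicOn d c (Ici 0) γ ∧ q 0 = 1 ∧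
      γ 0 = 1 ∧ ∀ u, 0 ≤ u → ∀ r, u - 2 * c - 1 ≤ d (γ u) (q r) := by
  have h : ∀ n : ℕ, ∃ q γ : ℝ → Γ, IsQuasiGeodesicOn d c univ q ∧
      IsQuasiGeodesicOn d c (Icc 0 n) γ ∧ q 0 = 1 ∧ γ 0 = 1 ∧
      ∀ u ∈ Icc (0 : ℝ) n, ∀ r, u - 2 * c - 1 ≤ d (γ u) (q r) := by
    intro n
    obtain ⟨x, hx⟩ := hfar (n + c)
    have hbdd : BddBelow (range fun r => d x (p r)) := ⟨0, by rintro _ ⟨r, rfl⟩; exact hnonneg _ _⟩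
    obtain ⟨a, ha⟩ := exists_lt_of_ciInf_lt
      (lt_add_one (⨅ r, d x (p r)))
    have hmin : ∀ r, d x (p a) - 1 ≤ d x (p r) := fun r => by
      have := ciInf_le hbdd r
      linarith
    obtain ⟨s, t, γ, hst, hs, rfl, hγ⟩ := hqg (p a) x
    have h1 := (hγ s ⟨le_rfl, hst⟩ t ⟨hst, le_rfl⟩)
    rw [abs_sub_comm, abs_of_nonneg (sub_nonneg.2 hst), hs, hsymm] at h1
    have h2 := hx a
    have hmem : ∀ r ∈ Icc (0 : ℝ) n, s + r ∈ Icc s t := by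
      rintro r ⟨hr1, hr2⟩
      constructor <;> linarith
    refine ⟨_, _, hp.translate hinv (p a)⁻¹ a fun _ _ => mem_univ _,
      hγ.translate hinv (p a)⁻¹ s hmem, by simp, by simp [hs], ?_⟩
    intro u hu r
    rw [hinv]
    have h3 := htri (γ t) (γ (s + u)) (p (a + r))
    have h4 := hmin (a + r)
    have h5 := (hγ t ⟨hst, le_rfl⟩ (s + u) (hmem u hu)).2
    rw [abs_of_nonneg (by linarith [(hmem u hu).2])] at h5
    linarith
  choose q γ hq hγ hq0 hγ0 hd using h
  have hev : ∀ r ∈ Ici (0 : ℝ), ∀ᶠ n : ℕ in (hyperfilter ℕ : Ultrafilter ℕ),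
      r ∈ Icc (0 : ℝ) n := by
    intro r hr
    refine Filter.Eventually.filter_mono Nat.hyperfilter_le_atTop ?_
    filter_upwards [eventually_ge_atTop ⌈r⌉₊] with n hn
    exact ⟨hr, (Nat.le_ceil _).trans (by exact_mod_cast hn)⟩
  obtain ⟨q', hq', hq0', hqe⟩ := exists_quasiGeodesic_ultralimit hproper (hyperfilter ℕ) q
    (fun _ => univ) univ (mem_univ _) (by simp) hq hq0
  obtain ⟨γ', hγ', hγ0', hγe⟩ := exists_quasiGeodesic_ultralimit hproper (hyperfilter ℕ) γ
    (fun n => Icc 0 n) (Ici 0) (le_refl (0 : ℝ)) hev hγ hγ0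
  refine ⟨q', γ', hq', hγ', hq0', hγ0', fun u hu r => ?_⟩
  obtain ⟨n, h1, h2, h3⟩ := ((hqe r (mem_univ _)).and ((hγe u hu).and (hev u hu))).exists
  rw [← h1, ← h2]
  exact hd n u h3 r

theorem zpowers_finiteIndex_of_shift {Γ : Type*} [Group Γ] {φ : Γ → ℝ}
    (hfin : ∀ B : ℝ, {x : Γ | |φ x| ≤ B}.Finite) {g : Γ} {a D : ℝ} (haD : D < a)
    (hg : ∀ x, |φ (g * x) - φ x - a| ≤ D) : (Subgroup.zpowers g).FiniteIndex := by
  have hpow : ∀ (n : ℕ) (x : Γ), φ x + n * (a - D) ≤ φ (g ^ n * x) := by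
    intro n
    induction n with
    | zero => simp
    | succ n ih =>
      intro x
      have h1 := (abs_le.1 (hg (g ^ n * x))).1
      have h2 := ih x
      rw [pow_succ', mul_assoc]
      push_cast
      linarith
  have key : ∀ x, ∃ k : ℤ, |φ (g ^ k * x)| ≤ a + D := by
    intro x
    obtain ⟨N, hN⟩ := exists_nat_gt (|φ x| / (a - D))
    rw [div_lt_iff₀ (sub_pos.2 haD)] at hN
    obtain ⟨k, hk, hmax⟩ := Int.exists_greatest_of_bdd
      (P := fun k : ℤ => φ (g ^ k * x) ≤ 0) ⟨N, by
        intro z hz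
        by_contra! hlt
        obtain ⟨n, rfl⟩ := Int.eq_ofNat_of_zero_le (by lia : 0 ≤ z)
        have h1 := hpow n x
        have h2 : (N : ℝ) < n := by exact_mod_cast hlt
        have h3 : (N : ℝ) * (a - D) ≤ n * (a - D) :=
          mul_le_mul_of_nonneg_right h2.le (sub_pos.2 haD).le
        have h4 := neg_abs_le (φ x)
        rw [zpow_natCast] at hz
        linarith⟩ ⟨-N, by
        have h1 := hpow N (g ^ (-N : ℤ) * x)
        rw [← mul_assoc, ← zpow_natCast, ← zpow_add, add_neg_cancel, zpow_zero, one_mul] at h1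
        linarith [le_abs_self (φ x)]⟩
    have h1 : 0 < φ (g ^ (k + 1) * x) := by
      by_contra! h
      have := hmax _ h
      lia
    have h2 := (abs_le.1 (hg (g ^ k * x))).2
    rw [← mul_assoc, ← zpow_one_add, add_comm] at h2
    exact ⟨k, abs_le.2 ⟨by linarith, by linarith [(abs_nonneg _).trans (hg 1)]⟩⟩
  have : Finite {x : Γ | |φ x| ≤ a + D} := hfin _
  have hsurj : Function.Surjective (fun f : {x : Γ | |φ x| ≤ a + D} =>
      (QuotientGroup.mk (f : Γ)⁻¹ : Γ ⧸ Subgroup.zpowers g)) := by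
    intro y
    obtain ⟨x, rfl⟩ := QuotientGroup.mk_surjective y
    obtain ⟨k, hk⟩ := key x⁻¹
    refine ⟨⟨_, hk⟩, QuotientGroup.eq.2 ⟨k, by simp⟩⟩
  have : Finite (Γ ⧸ Subgroup.zpowers g) := Finite.of_surjective _ hsurj
  exact Subgroup.finiteIndex_of_finite_quotient

/-- A coarse isometry between subsets of the line preserves or reverses the orientation. -/
theorem coarse_translation_or_reflection {X : Type*} {f h : X → ℝ} {K : ℝ} {o : X}
    (hf : f o = 0) (hh : h o = 0) (H : ∀ x y, |(|f x - f y| - |h x - h y|)| ≤ K) :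
    (∀ x, |f x - h x| ≤ 5 * K) ∨ ∀ x, |f x + h x| ≤ 5 * K := by
  by_contra! hcon
  obtain ⟨⟨x, hx⟩, ⟨y, hy⟩⟩ := hcon
  have h1 := H x o
  have h2 := H y o
  have h3 := H x y
  simp only [hf, hh, sub_zero] at h1 h2
  have hx' : |f x + h x| ≤ K := by grind
  have hy' : |f y - h y| ≤ K := by grind
  rw [abs_le] at h3 hx' hy'
  rcases lt_abs.1 hx with hx | hx <;> rcases lt_abs.1 hy with hy | hy <;>
  rcases abs_cases (f x - f y) with ⟨e1, _⟩ | ⟨e1, _⟩ <;>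
  rcases abs_cases (h x - h y) with ⟨e2, _⟩ | ⟨e2, _⟩ <;>
  rw [e1, e2] at h3 <;> linarith

/-- An infinite group with a proper coarse isometry to a subset of the line is virtually cyclic. -/
theorem virtually_cyclic_of_coarse_line {Γ : Type*} [Group Γ] [Infinite Γ] {d : Γ → Γ → ℝ}
    (hinv : ∀ g x y : Γ, d (g * x) (g * y) = d x y)
    (hproper : ∀ R : ℝ, {g : Γ | d 1 g ≤ R}.Finite) {φ : Γ → ℝ} {E : ℝ}
    (hφ : ∀ x y, |(|φ x - φ y| - d x y)| ≤ E) :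
    ∃ H : Subgroup Γ, H.FiniteIndex ∧ IsCyclic H := by
  have hfin : ∀ B : ℝ, {x : Γ | |φ x| ≤ B}.Finite := by
    intro B
    refine (hproper (|φ 1| + B + E)).subset fun x hx => ?_
    have h1 := (abs_le.1 (hφ 1 x)).1
    have h2 := abs_sub (φ 1) (φ x)
    have hx : |φ x| ≤ B := hx
    show d 1 x ≤ _
    linarith
  have hlarge : ∀ B : ℝ, ∃ x, B < |φ x| := fun B => by
    obtain ⟨x, hx⟩ := (hfin B).infinite_compl.nonempty
    exact ⟨x, not_le.1 hx⟩
  suffices h : ∃ (g : Γ) (a D : ℝ), D < |a| ∧ ∀ x, |φ (g * x) - φ x - a| ≤ D by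
    obtain ⟨g, a, D, ha, hg⟩ := h
    rcases lt_abs.1 ha with ha | ha
    · exact ⟨_, zpowers_finiteIndex_of_shift hfin ha hg, inferInstance⟩
    · refine ⟨_, zpowers_finiteIndex_of_shift (g := g⁻¹) hfin ha fun x => ?_, inferInstance⟩
      have := hg (g⁻¹ * x)
      rw [mul_inv_cancel_left] at this
      rw [← abs_neg]
      convert this using 2
      ring
  obtain ⟨D, hD⟩ : ∃ D, D = 5 * (2 * E) + |φ 1| := ⟨_, rfl⟩
  have hdich : ∀ g, (∀ x, |φ (g * x) - φ g - φ x| ≤ D) ∨ ∀ x, |φ (g * x) - φ g + φ x| ≤ D := by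
    intro g
    rcases coarse_translation_or_reflection (f := fun x => φ (g * x) - φ g)
      (h := fun x => φ x - φ 1) (K := 2 * E) (o := (1 : Γ)) (by simp) (by simp) (by
        intro x y
        have h1 := abs_le.1 (hφ (g * x) (g * y))
        have h2 := abs_le.1 (hφ x y)
        rw [hinv] at h1
        simp only [sub_sub_sub_cancel_right]
        rw [abs_le]
        constructor <;> linarith) with h | h
    · refine Or.inl fun x => ?_
      have h1 := abs_le.1 (h x)
      rw [abs_le]
      constructor <;> linarith [neg_abs_le (φ 1), le_abs_self (φ 1)]
    · refine Or.inr fun x => ?_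
      have h1 := abs_le.1 (h x)
      rw [abs_le]
      constructor <;> linarith [neg_abs_le (φ 1), le_abs_self (φ 1)]
  obtain ⟨g₁, hg₁⟩ := hlarge (2 * D)
  obtain ⟨g₂, hg₂⟩ := hlarge (|φ g₁| + 2 * D)
  have hD0 : 0 ≤ D := by
    rcases hdich 1 with h | h <;> exact (abs_nonneg _).trans (h 1)
  rcases hdich g₁ with h₁ | h₁
  · refine ⟨g₁, φ g₁, D, by linarith, fun x => ?_⟩
    rw [sub_right_comm]
    exact h₁ x
  rcases hdich g₂ with h₂ | h₂
  · refine ⟨g₂, φ g₂, D, by linarith [abs_nonneg (φ g₁)], fun x => ?_⟩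
    rw [sub_right_comm]
    exact h₂ x
  refine ⟨g₁ * g₂, φ g₁ - φ g₂, 2 * D, ?_, fun x => ?_⟩
  · have := abs_sub_abs_le_abs_sub (φ g₂) (φ g₁)
    rw [abs_sub_comm]
    linarith
  · have e1 := abs_le.1 (h₁ (g₂ * x))
    have e2 := abs_le.1 (h₂ x)
    rw [mul_assoc, abs_le]
    constructor <;> linarith

/-- A group which is not virtually cyclic has three rays from the identity with pairwise bounded
Gromov products. -/
theorem exists_three_rays {Γ : Type*} [Group Γ] [Infinite Γ] {d : Γ → Γ → ℝ}
    (hsymm : ∀ x y : Γ, d x y = d y x) (htri : ∀ x y z : Γ, d x z ≤ d x y + d y z)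
    (hnonneg : ∀ x y : Γ, 0 ≤ d x y)
    (hinv : ∀ g x y : Γ, d (g * x) (g * y) = d x y)
    (hproper : ∀ R : ℝ, {g : Γ | d 1 g ≤ R}.Finite) {δ c : ℝ} (hδ : 0 ≤ δ) (hc : 0 < c)
    (hhyp : ∀ x y z w, min (gromovProd d x z w) (gromovProd d y z w) - δ ≤ gromovProd d x y w)
    (hqg : ∀ x y : Γ, ∃ (s t : ℝ) (γ : ℝ → Γ), s ≤ t ∧ γ s = x ∧ γ t = y ∧
      IsQuasiGeodesicOn d c (Icc s t) γ)
    (hnonelem : ¬ ∃ H : Subgroup Γ, H.FiniteIndex ∧ IsCyclic H) :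
    ∃ (K : ℝ) (r : Fin 3 → ℝ → Γ), (∀ a, IsQuasiGeodesicOn d c (Ici 0) (r a) ∧ r a 0 = 1) ∧
      ∀ a b, a < b → ∀ i j, 0 ≤ i → 0 ≤ j → gromovProd d (r a i) (r b j) 1 ≤ K := by
  obtain ⟨p, hp⟩ := exists_biinfinite_quasiGeodesic hinv hproper hqg
  have hfar : ∀ R : ℝ, ∃ x, ∀ r, R < d x (p r) := by
    by_contra! hnear
    obtain ⟨R, hR⟩ := hnear
    choose φ hφ using hR
    refine hnonelem (virtually_cyclic_of_coarse_line hinv hproper (φ := φ) (E := 2 * R + c) ?_)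
    intro x y
    have h1 := hp (φ x) (mem_univ _) (φ y) (mem_univ _)
    have h2 := htri x (p (φ x)) y
    have h3 := htri (p (φ x)) (p (φ y)) y
    have h4 := htri (p (φ x)) x (p (φ y))
    have h5 := htri x y (p (φ y))
    have h6 := hsymm x (p (φ x))
    have h7 := hsymm y (p (φ y))
    have h8 := hφ x
    have h9 := hφ y
    rw [abs_le]
    constructor <;> linarith
  obtain ⟨q, γ, hq, hγ, hq0, hγ0, hd⟩ :=
    exists_orthogonal_ray hsymm htri hnonneg hinv hproper hqg hp hfar
  have hq' : IsQuasiGeodesicOn d c (Ici 0) (fun r => q (-r)) := by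
    intro i _ j _
    have := hq (-i) (mem_univ _) (-j) (mem_univ _)
    rwa [← neg_sub', abs_neg] at this
  refine ⟨8 * c + 4 * δ + 1, ![γ, q, fun r => q (-r)], ?_, ?_⟩
  · intro a
    fin_cases a
    · exact ⟨hγ, hγ0⟩
    · exact ⟨hq.mono (subset_univ _), hq0⟩
    · exact ⟨hq', by simpa using hq0⟩
  · have h01 : ∀ i j, 0 ≤ i → 0 ≤ j → gromovProd d (γ i) (q j) 1 ≤ 8 * c + 4 * δ + 1 := by
      intro i j hi hj
      rw [← hγ0]
      exact gromovProd_le_of_diverge hsymm htri hδ hc hhyp hγ (hq.mono (subset_univ _))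
        (hγ0.trans hq0.symm) (fun u hu => hd u hu u) hi hj
    have h02 : ∀ i j, 0 ≤ i → 0 ≤ j → gromovProd d (γ i) (q (-j)) 1 ≤ 8 * c + 4 * δ + 1 := by
      intro i j hi hj
      rw [← hγ0]
      exact gromovProd_le_of_diverge hsymm htri hδ hc hhyp hγ hq'
        (by simp [hγ0, hq0]) (fun u hu => hd u hu (-u)) hi hj
    have h12 : ∀ i j, 0 ≤ i → 0 ≤ j → gromovProd d (q i) (q (-j)) 1 ≤ 8 * c + 4 * δ + 1 := by
      intro i j hi hj
      have h1 := (hq i (mem_univ _) 0 (mem_univ _)).2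
      have h2 := (hq (-j) (mem_univ _) 0 (mem_univ _)).2
      have h3 := (hq i (mem_univ _) (-j) (mem_univ _)).1
      rw [sub_zero, abs_of_nonneg hi, hq0] at h1
      rw [sub_zero, abs_neg, abs_of_nonneg hj, hq0] at h2
      rw [sub_neg_eq_add, abs_of_nonneg (add_nonneg hi hj)] at h3
      rw [gromovProd]
      linarith
    intro a b hab
    fin_cases a <;> fin_cases b <;> first | exact absurd hab (by decide) | assumption

/-- Among three rays with pairwise bounded Gromov products, one stays away from two given
points. -/
theorem exists_ray_away_from_pair {X : Type*} {d : X → X → ℝ} {δ K : ℝ} {o : X}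
    (hhyp : ∀ x y z w, min (gromovProd d x z w) (gromovProd d y z w) - δ ≤ gromovProd d x y w)
    {r : Fin 3 → ℝ → X}
    (hr : ∀ a b, a < b → ∀ i j, 0 ≤ i → 0 ≤ j → gromovProd d (r a i) (r b j) o ≤ K) (y z : X) :
    ∃ a, ∀ i, 0 ≤ i → gromovProd d (r a i) y o ≤ K + δ ∧ gromovProd d (r a i) z o ≤ K + δ := by
  have hone : ∀ y a b, a < b → (∀ i, 0 ≤ i → gromovProd d (r a i) y o ≤ K + δ) ∨
      ∀ i, 0 ≤ i → gromovProd d (r b i) y o ≤ K + δ := by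
    intro y a b hab
    by_contra! hcon
    obtain ⟨⟨i, hi, hi'⟩, j, hj, hj'⟩ := hcon
    have h1 := hhyp (r a i) (r b j) y o
    have h2 := hr a b hab i j hi hj
    have h3 := lt_min hi' hj'
    linarith
  have y01 := hone y 0 1 (by decide)
  have y02 := hone y 0 2 (by decide)
  have y12 := hone y 1 2 (by decide)
  have z01 := hone z 0 1 (by decide)
  have z02 := hone z 0 2 (by decide)
  have z12 := hone z 1 2 (by decide)
  have : ∃ a, (∀ i, 0 ≤ i → gromovProd d (r a i) y o ≤ K + δ) ∧
      ∀ i, 0 ≤ i → gromovProd d (r a i) z o ≤ K + δ := by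
    by_contra! hcon
    have h0 := hcon 0
    have h1 := hcon 1
    have h2 := hcon 2
    grind
  obtain ⟨a, h1, h2⟩ := this
  exact ⟨a, fun i hi => ⟨h1 i hi, h2 i hi⟩⟩

theorem stmt_14
    {Γ : Type} [Group Γ] [Countable Γ] (d : Γ → Γ → ℝ)
    (hzero : ∀ x y : Γ, d x y = 0 ↔ x = y)
    (hsymm : ∀ x y : Γ, d x y = d y x)
    (htri : ∀ x y z : Γ, d x z ≤ d x y + d y z)
    (hinv : ∀ g x y : Γ, d (g * x) (g * y) = d x y)
    (hproper : ∀ R : ℝ, {g : Γ | d 1 g ≤ R}.Finite)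
    (hhyp : ∃ δ : ℝ, 0 ≤ δ ∧ ∀ x y z w : Γ,
      (d x w + d y w - d x y) / 2 ≥
        min ((d x w + d z w - d x z) / 2) ((d y w + d z w - d y z) / 2) - δ)
    (hqg : ∃ c : ℝ, 0 < c ∧ ∀ x y : Γ, ∃ (s t : ℝ) (γ : ℝ → Γ), s ≤ t ∧ γ s = x ∧ γ t = y ∧
      ∀ i ∈ Set.Icc s t, ∀ j ∈ Set.Icc s t,
        |i - j| - c ≤ d (γ i) (γ j) ∧ d (γ i) (γ j) ≤ |i - j| + c)
    (hinfinite : Infinite Γ)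
    (hnonelem : ¬ ∃ H : Subgroup Γ, H.FiniteIndex ∧ IsCyclic H) :
    ∃ C : ℝ, 0 < C ∧ ∀ g : Γ, ∃ x : ℕ → Γ,
      -- {x_i} is a Gromov sequence: (x_i|x_j)_e → ∞
      Tendsto (fun ij : ℕ × ℕ =>
        (d (x ij.1) 1 + d (x ij.2) 1 - d (x ij.1) (x ij.2)) / 2) atTop atTop ∧
      -- limsup_i |d(x_i,g) − d(x_i,e)| ≤ C
      ∀ ε : ℝ, 0 < ε → ∀ᶠ i : ℕ in atTop, |d (x i) g - d (x i) 1| ≤ C + ε := by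
  obtain ⟨δ, hδ, hhyp⟩ := hhyp
  obtain ⟨c, hc, hqg⟩ := hqg
  have hnonneg : ∀ x y, 0 ≤ d x y := fun x y => by
    linarith [htri x y x, hsymm x y, (hzero x x).2 rfl]
  obtain ⟨K, r, hr, hK⟩ := exists_three_rays hsymm htri hnonneg hinv hproper hδ hc hhyp hqg hnonelem
  refine ⟨|2 * c + 2 * (K + δ)| + 1, by positivity, fun g => ?_⟩
  obtain ⟨s, t, γ, hst, hs, ht, hγ⟩ := hqg 1 g
  obtain ⟨m, hm⟩ : ∃ m, m = γ ((s + t) / 2) := ⟨_, rfl⟩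
  have hmid : (s + t) / 2 ∈ Icc s t := by constructor <;> linarith
  have h1 := hγ _ hmid s ⟨le_rfl, hst⟩
  have h2 := hγ _ hmid t ⟨hst, le_rfl⟩
  rw [← hm, hs, abs_of_nonneg (by linarith)] at h1
  rw [← hm, ht, abs_of_nonpos (by linarith)] at h2
  obtain ⟨a, ha⟩ := exists_ray_away_from_pair hhyp hK m⁻¹ (m⁻¹ * g)
  have hmove : ∀ x y, d (m * x) y = d x (m⁻¹ * y) := fun x y => by
    rw [← hinv m x, mul_inv_cancel_left]
  have hm1 : d m⁻¹ 1 = d m 1 := by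
    rw [← hinv m, mul_inv_cancel, mul_one, hsymm]
  have hmg : d (m⁻¹ * g) 1 = d m g := by
    rw [← hinv m, mul_inv_cancel_left, mul_one, hsymm]
  refine ⟨fun i => m * r a i, ?_, ?_⟩
  · have hlow : ∀ ij : ℕ × ℕ, ((min ij.1 ij.2 : ℕ) : ℝ) + (- (3 * c / 2) - d m 1) ≤
        (d (m * r a ij.1) 1 + d (m * r a ij.2) 1 - d (m * r a ij.1) (m * r a ij.2)) / 2 := by
      rintro ⟨i, j⟩
      have hprod : ((min i j : ℕ) : ℝ) - 3 * c / 2 ≤ gromovProd d (r a i) (r a j) 1 := by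
        rw [← (hr a).2]
        rcases le_total i j with hij | hij
        · rw [min_eq_left hij]
          exact (hr a).1.sub_le_gromovProd (Nat.cast_nonneg _) (Nat.cast_le.2 hij)
        · rw [min_eq_right hij]
          have := (hr a).1.sub_le_gromovProd (Nat.cast_nonneg _) (Nat.cast_le.2 hij)
          rw [gromovProd] at this ⊢
          rw [hsymm (r a i) (r a j)]
          linarith
      rw [gromovProd] at hprod
      simp only [hinv, hmove, mul_one]
      have e1 := htri (r a i) m⁻¹ 1
      have e2 := htri (r a j) m⁻¹ 1
      linarith
    refine tendsto_atTop_mono hlow (tendsto_atTop_add_const_right _ _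
      (tendsto_natCast_atTop_atTop.comp ?_))
    refine tendsto_atTop.2 fun n => ?_
    filter_upwards [eventually_ge_atTop (n, n)] with ij hij
    exact le_min hij.1 hij.2
  · intro ε hε
    refine Eventually.of_forall fun i => ?_
    obtain ⟨e1, e2⟩ := ha i (Nat.cast_nonneg _)
    have e3 := htri (r a i) 1 m⁻¹
    have e4 := htri (r a i) 1 (m⁻¹ * g)
    rw [gromovProd, hm1] at e1
    rw [gromovProd, hmg] at e2
    rw [hsymm 1, hm1] at e3
    rw [hsymm 1, hmg] at e4
    have e5 := le_abs_self (2 * c + 2 * (K + δ))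
    simp only [hmove, mul_one]
    rw [abs_le]
    constructor <;> linarith
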